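/- arXiv:1909.08668 — 3 statements merged into one kernel-verified Lean document; each statement's English description precedes it below -/
import Mathlib

section
/- For every x ∈ V, the diagonal matrix entry of the Hamiltonian equals the corresponding diagonal entry of the reduced operator: H(x,x) = (J δ_{Π x})(Π x), i.e. (H 1_x)(x) = ⟨δ_{Π x} | J δ_{Π x}⟩ in the standard basis of ℂ^{0,…,N}. -/
noncomputable section

/-- The transversal layer `Π⁻¹(n)` as a finset. -/
def layer {V : Type} [Fintype V] {N : ℕ} (proj : V → Fin (N + 1)) (n : Fin (N + 1)) :
    Finset V :=
  Finset.univ.filter (fun x => proj x = n)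

/-- The weight `μ(x) = 1/|Π⁻¹(Π x)|`. -/
def mu {V : Type} [Fintype V] {N : ℕ} (proj : V → Fin (N + 1)) (x : V) : ℂ :=
  ((layer proj (proj x)).card : ℂ)⁻¹

/-- The weighted inner product `⟨ψ,φ⟩_G = Σ_x ψ(x) conj(φ(x)) μ(x)` on `ℂ^V`. -/
def innerG {V : Type} [Fintype V] {N : ℕ} (proj : V → Fin (N + 1)) (ψ φ : V → ℂ) : ℂ :=
  ∑ x, ψ x * (starRingEnd ℂ) (φ x) * mu proj x

/-- The standard inner product on `ℂ^{0,…,N}`. -/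
def innerStd {N : ℕ} (ψ φ : Fin (N + 1) → ℂ) : ℂ :=
  ∑ n, ψ n * (starRingEnd ℂ) (φ n)

/-- The averaging map `P : ℂ^V → ℂ^{0,…,N}`. -/
def avg {V : Type} [Fintype V] {N : ℕ} (proj : V → Fin (N + 1)) (ψ : V → ℂ) :
    Fin (N + 1) → ℂ :=
  fun n => ((layer proj n).card : ℂ)⁻¹ * ∑ x ∈ layer proj n, ψ x

/-- The map `P* : ℂ^{0,…,N} → ℂ^V`, `(P*φ)(x) = φ(Π x)`. -/
def lift {V : Type} {N : ℕ} (proj : V → Fin (N + 1)) (φ : Fin (N + 1) → ℂ) : V → ℂ :=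
  fun x => φ (proj x)

/-- `deg₊(x)`: the number of neighbors of `x` in the next layer. -/
def degPlus {V : Type} [Fintype V] {N : ℕ} (proj : V → Fin (N + 1))
    (Adj : V → V → Prop) [DecidableRel Adj] (x : V) : ℕ :=
  (Finset.univ.filter (fun y => Adj x y ∧ (proj y : ℕ) = (proj x : ℕ) + 1)).card

/-- `deg₋(x)`: the number of neighbors of `x` in the previous layer. -/
def degMinus {V : Type} [Fintype V] {N : ℕ} (proj : V → Fin (N + 1))
    (Adj : V → V → Prop) [DecidableRel Adj] (x : V) : ℕ :=
  (Finset.univ.filter (fun y => Adj x y ∧ (proj y : ℕ) + 1 = (proj x : ℕ))).card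

theorem card_layer_proj_ne_zero {V : Type} [Fintype V] {N : ℕ} (proj : V → Fin (N + 1))
    (x : V) : (layer proj (proj x)).card ≠ 0 :=
  Finset.card_ne_zero_of_mem (a := x) (by simp [layer])

theorem innerG_single_mulVec_single {V : Type} [Fintype V] [DecidableEq V] {N : ℕ}
    (proj : V → Fin (N + 1)) (H : Matrix V V ℂ) (x y : V) :
    innerG proj (Pi.single x 1) (H.mulVec (Pi.single y 1)) =
      (starRingEnd ℂ) (H x y) * mu proj x := by
  unfold innerG
  rw [Finset.sum_eq_single x]
  · simp
  · intro z _ hz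
    simp [Pi.single_eq_of_ne hz]
  · simp

theorem mulVec_lift_single_apply {V : Type} [Fintype V] {N : ℕ}
    (proj : V → Fin (N + 1)) (H : Matrix V V ℂ) {y : V}
    (hH : ∀ z, proj z = proj y → z ≠ y → H y z = 0) :
    H.mulVec (lift proj (Pi.single (proj y) 1)) y = H y y := by
  unfold Matrix.mulVec dotProduct lift
  rw [Finset.sum_eq_single y]
  · simp
  · intro z _ hz
    by_cases h : proj z = proj y
    · simp [hH z h hz]
    · simp [Pi.single_eq_of_ne h]
  · simp

/-- Proposition 1, part 1: for every vertex `x`, the diagonal matrix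
entry of the Hamiltonian equals the corresponding diagonal entry of the reduced operator:
`H(x,x) = (J δ_{Π x})(Π x)`. -/
theorem hamiltonian_diagonal_entry
    (V : Type) [Fintype V] [DecidableEq V] [Nonempty V]
    (N : ℕ) (hN : 1 ≤ N)
    (proj : V → Fin (N + 1)) (hsurj : Function.Surjective proj)
    (Adj : V → V → Prop) [DecidableRel Adj]
    (hAdjSymm : Symmetric Adj) (hAdjIrrefl : Irreflexive Adj)
    (hlayeredge : ∀ x y, Adj x y →
      (proj y : ℕ) = (proj x : ℕ) + 1 ∨ (proj x : ℕ) = (proj y : ℕ) + 1)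
    (hdegp : ∀ x y, proj x = proj y → degPlus proj Adj x = degPlus proj Adj y)
    (hdegm : ∀ x y, proj x = proj y → degMinus proj Adj x = degMinus proj Adj y)
    (xL xR : V)
    (hxL : layer proj 0 = {xL})
    (hxR : layer proj (Fin.last N) = {xR})
    (H : Matrix V V ℂ)
    (hNN : ∀ x y, x ≠ y → ¬ Adj x y → H x y = 0)
    (hSymCoup : ∀ x₁ y₁ x₂ y₂, Adj x₁ y₁ → Adj x₂ y₂ →
      proj x₁ = proj x₂ → proj y₁ = proj y₂ →
      innerG proj (Pi.single x₁ 1) (H.mulVec (Pi.single y₁ 1)) =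
        innerG proj (Pi.single x₂ 1) (H.mulVec (Pi.single y₂ 1)))
    (hDiag : ∀ x y, proj x = proj y →
      innerG proj (Pi.single x 1) (H.mulVec (Pi.single x 1)) =
        innerG proj (Pi.single y 1) (H.mulVec (Pi.single y 1)))
    (J : Matrix (Fin (N + 1)) (Fin (N + 1)) ℂ)
    (hJ : ∀ φ, J.mulVec φ = avg proj (H.mulVec (lift proj φ)))
    (x : V) :
    H x x = J.mulVec (Pi.single (proj x) (1 : ℂ)) (proj x) := by
  have hconst : ∀ y, proj y = proj x → H y y = H x x := by
    intro y hy
    have h := hDiag y x hy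
    have hmu : mu proj x ≠ 0 :=
      inv_ne_zero (Nat.cast_ne_zero.mpr (card_layer_proj_ne_zero proj x))
    have hmuy : mu proj y = mu proj x := by simp [mu, hy]
    rw [innerG_single_mulVec_single, innerG_single_mulVec_single, hmuy] at h
    exact (starRingEnd ℂ).injective (mul_right_cancel₀ hmu h)
  have hsum : ∀ y ∈ layer proj (proj x),
      H.mulVec (lift proj (Pi.single (proj x) 1)) y = H x x := by
    intro y hy
    have hyx : proj y = proj x := by simpa [layer] using hy
    rw [← hconst y hyx, ← hyx]
    refine mulVec_lift_single_apply proj H fun z hz hne => ?_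
    refine hNN y z hne.symm fun hadj => ?_
    have := hlayeredge y z hadj
    rw [hz] at this
    omega
  rw [hJ, avg, Finset.sum_congr rfl hsum, Finset.sum_const, nsmul_eq_mul,
    inv_mul_cancel_left₀ (Nat.cast_ne_zero.mpr (card_layer_proj_ne_zero proj x))]
end
end

section
/- The subspace L²_sym(G) of layer-constant functions is invariant under every Hamiltonian H: if ψ ∈ ℂ^V satisfies ψ(x) = ψ(y) whenever Π x = Π y, then Hψ also satisfies (Hψ)(x) = (Hψ)(y) whenever Π x = Π y. -/
noncomputable section

theorem mu_ne_zero {V : Type} [Fintype V] {N : ℕ} (proj : V → Fin (N + 1)) (x : V) :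
    mu proj x ≠ 0 :=
  inv_ne_zero (Nat.cast_ne_zero.mpr (Finset.card_ne_zero_of_mem (a := x) (by simp [layer])))

theorem mu_congr {V : Type} [Fintype V] {N : ℕ} {proj : V → Fin (N + 1)} {x y : V}
    (h : proj x = proj y) : mu proj x = mu proj y := by
  rw [mu, mu, h]

/-- Equality of couplings is equality of matrix entries, for pairs starting in the same layer. -/
theorem entry_eq_of_innerG_eq {V : Type} [Fintype V] [DecidableEq V] {N : ℕ}
    {proj : V → Fin (N + 1)} {H : Matrix V V ℂ} {x₁ y₁ x₂ y₂ : V} (hx : proj x₁ = proj x₂)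
    (h : innerG proj (Pi.single x₁ 1) (H.mulVec (Pi.single y₁ 1)) =
      innerG proj (Pi.single x₂ 1) (H.mulVec (Pi.single y₂ 1))) :
    H x₁ y₁ = H x₂ y₂ := by
  rw [innerG_single_mulVec_single, innerG_single_mulVec_single, mu_congr hx] at h
  exact (starRingEnd ℂ).injective (mul_right_cancel₀ (mu_ne_zero proj x₂) h)

theorem Finset.sum_eq_sum_of_card_eq_of_forall_eq {ι κ M : Type*} [AddCommMonoid M]
    {s : Finset ι} {t : Finset κ} {f : ι → M} {g : κ → M} (hcard : s.card = t.card)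
    (h : ∀ a ∈ s, ∀ b ∈ t, f a = g b) : ∑ a ∈ s, f a = ∑ b ∈ t, g b := by
  rcases t.eq_empty_or_nonempty with rfl | ⟨b, hb⟩
  · simp_all
  · obtain ⟨a, ha⟩ : s.Nonempty := by
      rw [← Finset.card_pos, hcard]
      exact Finset.card_pos.mpr ⟨b, hb⟩
    rw [Finset.sum_eq_card_nsmul fun a' ha' => h a' ha' b hb,
      Finset.sum_eq_card_nsmul fun b' hb' => (h a ha b' hb').symm.trans (h a ha b hb), hcard]

/-- A nearest-neighbor matrix acts through the diagonal and the two adjacent layers. -/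
theorem mulVec_eq_diag_add_sum_next_add_sum_prev {V : Type} [Fintype V] [DecidableEq V] {N : ℕ}
    {proj : V → Fin (N + 1)} {Adj : V → V → Prop} [DecidableRel Adj]
    (hlayeredge : ∀ x y, Adj x y →
      (proj y : ℕ) = (proj x : ℕ) + 1 ∨ (proj x : ℕ) = (proj y : ℕ) + 1)
    {H : Matrix V V ℂ} (hNN : ∀ x y, x ≠ y → ¬ Adj x y → H x y = 0) (ψ : V → ℂ) (x : V) :
    H.mulVec ψ x = H x x * ψ x +
      ∑ y with Adj x y ∧ (proj y : ℕ) = (proj x : ℕ) + 1, H x y * ψ y +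
      ∑ y with Adj x y ∧ (proj y : ℕ) + 1 = (proj x : ℕ), H x y * ψ y := by
  have hdiag : H x x * ψ x = ∑ y, if y = x then H x y * ψ y else 0 := by simp
  rw [hdiag, Finset.sum_filter, Finset.sum_filter, ← Finset.sum_add_distrib,
    ← Finset.sum_add_distrib]
  refine Finset.sum_congr rfl fun y _ => ?_
  by_cases hxy : Adj x y
  · have hne : y ≠ x := by
      rintro rfl
      have := hlayeredge y y hxy
      omega
    rcases hlayeredge x y hxy with h | h
    · simp [hxy, hne, h, add_assoc]
    · simp [hxy, hne, h, add_assoc]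
  · by_cases hyx : y = x
    · subst hyx
      simp
    · simp [hxy, hyx, hNN x y (Ne.symm hyx) hxy]

/-- Lemma 1: the subspace `L²_sym(G)` of layer-constant functions is
invariant under every Hamiltonian `H`: if `ψ` is constant on each transversal layer, then
so is `Hψ`. -/
theorem symSubspace_invariant
    (V : Type) [Fintype V] [DecidableEq V] [Nonempty V]
    (N : ℕ) (hN : 1 ≤ N)
    (proj : V → Fin (N + 1)) (hsurj : Function.Surjective proj)
    (Adj : V → V → Prop) [DecidableRel Adj]
    (hAdjSymm : Symmetric Adj) (hAdjIrrefl : Irreflexive Adj)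
    (hlayeredge : ∀ x y, Adj x y →
      (proj y : ℕ) = (proj x : ℕ) + 1 ∨ (proj x : ℕ) = (proj y : ℕ) + 1)
    (hdegp : ∀ x y, proj x = proj y → degPlus proj Adj x = degPlus proj Adj y)
    (hdegm : ∀ x y, proj x = proj y → degMinus proj Adj x = degMinus proj Adj y)
    (xL xR : V)
    (hxL : layer proj 0 = {xL})
    (hxR : layer proj (Fin.last N) = {xR})
    (H : Matrix V V ℂ)
    (hNN : ∀ x y, x ≠ y → ¬ Adj x y → H x y = 0)
    (hSymCoup : ∀ x₁ y₁ x₂ y₂, Adj x₁ y₁ → Adj x₂ y₂ →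
      proj x₁ = proj x₂ → proj y₁ = proj y₂ →
      innerG proj (Pi.single x₁ 1) (H.mulVec (Pi.single y₁ 1)) =
        innerG proj (Pi.single x₂ 1) (H.mulVec (Pi.single y₂ 1)))
    (hDiag : ∀ x y, proj x = proj y →
      innerG proj (Pi.single x 1) (H.mulVec (Pi.single x 1)) =
        innerG proj (Pi.single y 1) (H.mulVec (Pi.single y 1)))
    (J : Matrix (Fin (N + 1)) (Fin (N + 1)) ℂ)
    (hJ : ∀ φ, J.mulVec φ = avg proj (H.mulVec (lift proj φ)))
    (ψ : V → ℂ) (hψ : ∀ x y, proj x = proj y → ψ x = ψ y) :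
    ∀ x y, proj x = proj y → H.mulVec ψ x = H.mulVec ψ y := by
  intro x y hxy
  have hterm : ∀ a b, Adj x a → Adj y b → proj a = proj b → H x a * ψ a = H y b * ψ b := by
    intro a b ha hb hab
    rw [entry_eq_of_innerG_eq hxy (hSymCoup x a y b ha hb hxy hab), hψ a b hab]
  rw [mulVec_eq_diag_add_sum_next_add_sum_prev hlayeredge hNN,
    mulVec_eq_diag_add_sum_next_add_sum_prev hlayeredge hNN,
    entry_eq_of_innerG_eq hxy (hDiag x y hxy), hψ x y hxy]
  congr 1
  · congr 1
    refine Finset.sum_eq_sum_of_card_eq_of_forall_eq (hdegp x y hxy) fun a ha b hb => ?_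
    simp only [Finset.mem_filter, Finset.mem_univ, true_and] at ha hb
    exact hterm a b ha.1 hb.1 (Fin.ext (by rw [ha.2, hb.2, hxy]))
  · refine Finset.sum_eq_sum_of_card_eq_of_forall_eq (hdegm x y hxy) fun a ha b hb => ?_
    simp only [Finset.mem_filter, Finset.mem_univ, true_and] at ha hb
    exact hterm a b ha.1 hb.1 (Fin.ext (by omega))
end
end

section
/- Let K be the Krawtchouk Jacobi matrix, i.e. the case B_n = 0 for all n and J_n = √(n(N+1−n))/2 for n = 1,…,N. Then the eigenvalues of K are exactly λ_k = k − N/2 for k = 0,…,N; equivalently, the characteristic polynomial of K is ∏_{k=0}^N (λ − (k − N/2)), so consecutive eigenvalues differ by 1. -/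
noncomputable section

/-- The `(N+1) × (N+1)` symmetric tridiagonal (Jacobi) matrix with diagonal entries
`B 0, …, B N` and off-diagonal entries `𝐉_{n-1,n} = 𝐉_{n,n-1} = Jc n` for `n = 1, …, N`. -/
def jacobiMatrix (N : ℕ) (B Jc : ℕ → ℝ) : Matrix (Fin (N + 1)) (Fin (N + 1)) ℝ :=
  Matrix.of fun i j =>
    if (i : ℕ) = (j : ℕ) then B i
    else if (i : ℕ) + 1 = (j : ℕ) then Jc j
    else if (j : ℕ) + 1 = (i : ℕ) then Jc i
    else 0

/-- The `(N+1) × (N+1)` reversal (anti-diagonal permutation) matrix `R`,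
with `R_{m,n} = 1` iff `m + n = N`. -/
def revMatrix (N : ℕ) : Matrix (Fin (N + 1)) (Fin (N + 1)) ℝ :=
  Matrix.of fun i j => if (i : ℕ) + (j : ℕ) = N then 1 else 0

open Polynomial in
/-- The coefficients of `(1 + X)^k (1 - X)^l`, up to normalisation the values of the
Krawtchouk polynomials. -/
def krawtchoukCoeff (k l n : ℕ) : ℝ := ((1 + X : ℝ[X]) ^ k * (1 - X) ^ l).coeff n

open Polynomial in
lemma one_sub_sq_mul_derivative (k l : ℕ) :
    (1 - X ^ 2) * derivative ((1 + X : ℝ[X]) ^ k * (1 - X) ^ l) =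
      (C ((k : ℝ) - l) - C ((k : ℝ) + l) * X) * ((1 + X) ^ k * (1 - X) ^ l) := by
  have h1 : (1 + X : ℝ[X]) * derivative ((1 + X : ℝ[X]) ^ k) = C (k : ℝ) * (1 + X) ^ k := by
    cases k with
    | zero => simp
    | succ k => simp [derivative_pow]; ring
  have h2 : (1 - X : ℝ[X]) * derivative ((1 - X : ℝ[X]) ^ l) = - C (l : ℝ) * (1 - X) ^ l := by
    cases l with
    | zero => simp
    | succ l => simp [derivative_pow]; ring
  rw [derivative_mul, C_sub, C_add]
  linear_combination (1 - X) * (1 - X) ^ l * h1 + (1 + X) * (1 + X) ^ k * h2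

lemma krawtchoukCoeff_zero (k l : ℕ) : krawtchoukCoeff k l 0 = 1 := by
  simp [krawtchoukCoeff, Polynomial.coeff_zero_eq_eval_zero]

lemma krawtchoukCoeff_eq_zero {k l n : ℕ} (h : k + l < n) : krawtchoukCoeff k l n = 0 := by
  refine Polynomial.coeff_eq_zero_of_natDegree_lt (lt_of_le_of_lt ?_ h)
  compute_degree

lemma krawtchoukCoeff_one (k l : ℕ) :
    krawtchoukCoeff k l 1 = ((k : ℝ) - l) * krawtchoukCoeff k l 0 := by
  have h := congrArg (fun p => Polynomial.coeff p 0) (one_sub_sq_mul_derivative k l)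
  unfold krawtchoukCoeff
  generalize ((1 + Polynomial.X : Polynomial ℝ) ^ k * (1 - Polynomial.X) ^ l) = p at h ⊢
  simpa [Polynomial.mul_coeff_zero, Polynomial.coeff_derivative] using h

/-- The three-term recurrence in the degree. -/
lemma krawtchoukCoeff_add_two (k l n : ℕ) :
    ((n : ℝ) + 2) * krawtchoukCoeff k l (n + 2) + ((k : ℝ) + l - n) * krawtchoukCoeff k l n =
      ((k : ℝ) - l) * krawtchoukCoeff k l (n + 1) := by
  have h := congrArg (fun p => Polynomial.coeff p (n + 1)) (one_sub_sq_mul_derivative k l)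
  unfold krawtchoukCoeff
  generalize ((1 + Polynomial.X : Polynomial ℝ) ^ k * (1 - Polynomial.X) ^ l) = p at h ⊢
  rw [sub_mul, sub_mul, one_mul, mul_assoc] at h
  simp only [Polynomial.coeff_sub, Polynomial.coeff_C_mul, Polynomial.coeff_X_mul,
    pow_two, mul_assoc, Polynomial.coeff_derivative] at h
  cases n with
  | zero =>
    simp [Polynomial.mul_coeff_zero, Polynomial.coeff_derivative] at h ⊢
    linarith
  | succ n =>
    simp only [Polynomial.coeff_X_mul, Polynomial.coeff_derivative] at h
    push_cast at h ⊢
    linarith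

lemma sqrt_mul_sqrt_factorial_succ {N m : ℕ} (h : m < N) :
    √(((m : ℝ) + 1) * (N - m)) * √((m + 1).factorial * (N - (m + 1)).factorial) =
      (m + 1) * √(m.factorial * (N - m).factorial) := by
  obtain ⟨r, rfl⟩ := Nat.exists_eq_add_of_lt h
  have e1 : m + r + 1 - (m + 1) = r := by omega
  have e2 : m + r + 1 - m = r + 1 := by omega
  rw [e1, e2, ← Real.sqrt_mul (by push_cast; ring_nf; positivity),
    ← Real.sqrt_sq (by positivity : (0 : ℝ) ≤ m + 1), ← Real.sqrt_mul (by positivity),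
    Real.sqrt_sq (by positivity)]
  congr 1
  push_cast [Nat.factorial_succ]
  ring

lemma sqrt_mul_sqrt_factorial {N m : ℕ} (h : m < N) :
    √(((m : ℝ) + 1) * (N - m)) * √(m.factorial * (N - m).factorial) =
      (N - m) * √((m + 1).factorial * (N - (m + 1)).factorial) := by
  have h0 : (0 : ℝ) < N - m := sub_pos.2 (by exact_mod_cast h)
  have h1 := sqrt_mul_sqrt_factorial_succ h
  have h2 := Real.mul_self_sqrt (by positivity : (0 : ℝ) ≤ ((m : ℝ) + 1) * (N - m))
  have h3 : (0 : ℝ) < m + 1 := by positivity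
  apply mul_left_cancel₀ h3.ne'
  linear_combination (-√(((m : ℝ) + 1) * (N - m))) * h1 +
    √((m + 1).factorial * (N - (m + 1)).factorial) * h2

lemma jacobiMatrix_mulVec (N : ℕ) (Jc v : ℕ → ℝ) (hv : v (N + 1) = 0) (i : Fin (N + 1)) :
    (jacobiMatrix N (fun _ => 0) Jc).mulVec (fun j => v j) i =
      Jc (i + 1) * v (i + 1) + if (i : ℕ) = 0 then 0 else Jc i * v (i - 1) := by
  obtain ⟨i, hi⟩ := i
  have hentry (j : Fin (N + 1)) : jacobiMatrix N (fun _ => 0) Jc ⟨i, hi⟩ j * v j =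
      (if i + 1 = (j : ℕ) then Jc j * v j else 0) +
        if (j : ℕ) + 1 = i then Jc i * v j else 0 := by
    simp only [jacobiMatrix, Matrix.of_apply]
    split_ifs <;> first | omega | simp
  simp only [Matrix.mulVec, dotProduct, hentry]
  rw [Fin.sum_univ_eq_sum_range (fun j => (if i + 1 = j then Jc j * v j else 0) +
    if j + 1 = i then Jc i * v j else 0), Finset.sum_add_distrib, Finset.sum_ite_eq]
  congr 1
  · split_ifs with h
    · rfl
    · have : i = N := by simp at h; omega
      simp [this, hv]
  · cases i with
    | zero => simp
    | succ m =>
      simp only [Nat.add_right_cancel_iff, Finset.sum_ite_eq', Finset.mem_range]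
      simp [show m < N + 1 by omega]

lemma jacobiMatrix_krawtchouk_mulVec (k l : ℕ) :
    (jacobiMatrix (k + l) (fun _ => 0)
        (fun n => √((n : ℝ) * (((k + l : ℕ) : ℝ) + 1 - n)) / 2)).mulVec
      (fun j => √((j : ℕ).factorial * (k + l - j).factorial) * krawtchoukCoeff k l j) =
      (((k : ℝ) - l) / 2) •
        fun j : Fin (k + l + 1) =>
          √((j : ℕ).factorial * (k + l - j).factorial) * krawtchoukCoeff k l j := by
  ext i
  rw [jacobiMatrix_mulVec (k + l) _
    (fun j => √(j.factorial * (k + l - j).factorial) * krawtchoukCoeff k l j)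
    (by simp [krawtchoukCoeff_eq_zero])]
  obtain ⟨i, hi⟩ := i
  have hup : √(((i + 1 : ℕ) : ℝ) * (((k + l : ℕ) : ℝ) + 1 - (i + 1 : ℕ))) *
      (√((i + 1).factorial * (k + l - (i + 1)).factorial) * krawtchoukCoeff k l (i + 1)) =
      (i + 1) * √(i.factorial * (k + l - i).factorial) * krawtchoukCoeff k l (i + 1) := by
    rcases (Nat.lt_succ_iff.1 hi).lt_or_eq with h | rfl
    · rw [← sqrt_mul_sqrt_factorial_succ h, ← mul_assoc]
      congr 3
      push_cast
      ring
    · simp [krawtchoukCoeff_eq_zero]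
  cases i with
  | zero =>
    have h := krawtchoukCoeff_one k l
    simp only [Pi.smul_apply, smul_eq_mul, if_true] at hup ⊢
    push_cast at hup ⊢
    linear_combination hup / 2 + √(Nat.factorial 0 * (k + l - 0).factorial) / 2 * h
  | succ m =>
    have h := krawtchoukCoeff_add_two k l m
    have hdown := sqrt_mul_sqrt_factorial (N := k + l) (m := m) (by omega)
    have e : ((m : ℝ) + 1) * ((k + l : ℕ) + 1 - (m + 1)) = (m + 1) * ((k + l : ℕ) - m) := by ring
    simp only [Pi.smul_apply, smul_eq_mul, Nat.add_eq_zero_iff, one_ne_zero, and_false, if_false,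
      Nat.add_sub_cancel]
    rw [div_mul_eq_mul_div, hup, div_mul_eq_mul_div, Nat.cast_succ m, e, ← mul_assoc, hdown]
    push_cast
    linear_combination √((m + 1).factorial * (k + l - (m + 1)).factorial) / 2 * h

lemma isRoot_charpoly_of_mulVec_eq_smul {n R : Type*} [Fintype n] [DecidableEq n] [CommRing R]
    [IsDomain R] {M : Matrix n n R} {v : n → R} {t : R} (hv : v ≠ 0) (h : M.mulVec v = t • v) :
    M.charpoly.IsRoot t := by
  rw [Polynomial.IsRoot, Matrix.eval_charpoly, ← Matrix.exists_mulVec_eq_zero_iff]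
  refine ⟨v, hv, ?_⟩
  rw [Matrix.sub_mulVec, h, Matrix.scalar_apply, ← Matrix.smul_one_eq_diagonal, Matrix.smul_mulVec,
    Matrix.one_mulVec, sub_self]

open Polynomial in
/-- the Krawtchouk Jacobi matrix (`B_n = 0`, `J_n = √(n(N+1-n))/2`)
has characteristic polynomial `∏_{k=0}^N (λ - (k - N/2))`, i.e. its eigenvalues are
exactly `λ_k = k - N/2`, with consecutive gaps equal to `1`. -/
theorem krawtchouk_eigenvalues
    (N : ℕ) (hN : 1 ≤ N) :
    (jacobiMatrix N (fun _ => 0)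
        (fun n => Real.sqrt ((n : ℝ) * ((N : ℝ) + 1 - (n : ℝ))) / 2)).charpoly =
      ∏ k : Fin (N + 1), (X - C ((k : ℝ) - (N : ℝ) / 2)) := by
  refine eq_of_monic_of_dvd_of_natDegree_le
    (monic_prod_X_sub_C (fun k : Fin (N + 1) => (k : ℝ) - N / 2) Finset.univ)
    (Matrix.charpoly_monic _) ?_ ?_
  · refine Finset.prod_dvd_of_coprime (fun a _ b _ hab => ?_) fun k _ => ?_
    · refine pairwise_coprime_X_sub_C (s := fun k : Fin (N + 1) => (k : ℝ) - N / 2) ?_ hab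
      intro a b hab
      simpa [Fin.ext_iff] using hab
    · rw [dvd_iff_isRoot]
      obtain ⟨k, hk⟩ := k
      obtain ⟨l, rfl⟩ := Nat.exists_eq_add_of_le (Nat.lt_succ_iff.1 hk)
      have ht : (k : ℝ) - ((k + l : ℕ) : ℝ) / 2 = ((k : ℝ) - l) / 2 := by
        push_cast
        ring
      simp only [ht]
      refine isRoot_charpoly_of_mulVec_eq_smul (fun h => ?_) (jacobiMatrix_krawtchouk_mulVec k l)
      have h0 := congrFun h 0
      simp [krawtchoukCoeff_zero, Nat.factorial_ne_zero] at h0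
  · rw [Matrix.charpoly_natDegree_eq_dim,
      natDegree_prod_of_monic _ _ fun k _ => monic_X_sub_C _]
    simp only [natDegree_X_sub_C, Finset.sum_const, Finset.card_univ, smul_eq_mul, mul_one, le_refl]
end
end
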